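/- Consider scalings K_n, P_n, α_n such that α_n(1 − q(θ_n)) ∼ c·(log n)/n as n → ∞ (i.e., the ratio of the two sides tends to 1) for some constant c > 0. Then lim_{n→∞} P_n(θ_n, α_n) = 0 if 0 < c < 1, and lim_{n→∞} P_n(θ_n, α_n) = 1 if c > 1. No assumption on the convergence of the sequence α_n log n is required. -/

import Mathlib

open Filter Finset

noncomputable section

/-- Key rings: `K`-element subsets of a pool `{1,…,P}` of keys. -/
abbrev KeyRing (P K : ℕ) : Type := {S : Finset (Fin P) // S.card = K}

/-- Unordered node pairs, represented as ordered pairs `(i,j)` with `i < j`. -/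
abbrev Pairs (n : ℕ) : Type := {e : Fin n × Fin n // e.1 < e.2}

/-- The number `C(P,K)` of possible key rings. -/
def numKR (P K : ℕ) : ℝ := (P.choose K : ℝ)

/-- Probability weight of a configuration `(κ, b)` under the product of the uniform
distribution on key rings (i.i.d. over the `n` nodes) and i.i.d. Bernoulli(α)
on/off link variables (one per unordered pair of nodes). -/
def wt (n P K : ℕ) (α : ℝ) (κ : Fin n → KeyRing P K) (b : Pairs n → Bool) : ℝ :=
  (numKR P K)⁻¹ ^ n * ∏ e : Pairs n, (if b e then α else 1 - α)

/-- The on/off state of the channel between nodes `i` and `j`. -/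
def link {n : ℕ} (b : Pairs n → Bool) (i j : Fin n) : Bool :=
  if h : i < j then b ⟨(i, j), h⟩
  else if h' : j < i then b ⟨(j, i), h'⟩
  else false

/-- Adjacency in the intersection graph `K ∩ G(n; θ, α)`:  the key rings of `i` and `j`
intersect and the channel between them is on. -/
abbrev Adj {n P K : ℕ} (κ : Fin n → KeyRing P K) (b : Pairs n → Bool) (i j : Fin n) : Prop :=
  i ≠ j ∧ ((κ i).1 ∩ (κ j).1).Nonempty ∧ link b i j = true

/-- Node `i` is isolated: it is adjacent to no other node. -/
abbrev Isolated {n P K : ℕ} (κ : Fin n → KeyRing P K) (b : Pairs n → Bool) (i : Fin n) : Prop :=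
  ∀ j, ¬ Adj κ b i j

/-- `P_n(θ,α)`: probability that `K ∩ G(n; θ, α)` contains no isolated nodes. -/
def probNoIsolated (n P K : ℕ) (α : ℝ) : ℝ :=
  ∑ κ : Fin n → KeyRing P K, ∑ b : Pairs n → Bool,
    wt n P K α κ b * (if ∀ i, ¬ Isolated κ b i then 1 else 0)

/-- Number of isolated nodes in the configuration `(κ, b)`. -/
def numIsolated {n P K : ℕ} (κ : Fin n → KeyRing P K) (b : Pairs n → Bool) : ℕ :=
  (Finset.univ.filter fun i => Isolated κ b i).card

/-- `E[I_n(θ,α)]`: expected number of isolated nodes in `K ∩ G(n; θ, α)`. -/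
def expIsolated (n P K : ℕ) (α : ℝ) : ℝ :=
  ∑ κ : Fin n → KeyRing P K, ∑ b : Pairs n → Bool,
    wt n P K α κ b * (numIsolated κ b : ℝ)

/-- `q(θ) = C(P−K,K)/C(P,K)` if `2K ≤ P`, and `0` otherwise. -/
def q (K P : ℕ) : ℝ :=
  if 2 * K ≤ P then ((P - K).choose K : ℝ) / (P.choose K : ℝ) else 0

/-- `v(θ;r) = C(P−r,K)/C(P,K)` if `r ≤ P−K`, and `0` otherwise. -/
def v (K P r : ℕ) : ℝ :=
  if r ≤ P - K then ((P - r).choose K : ℝ) / (P.choose K : ℝ) else 0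

end

/-- Key rings meet. -/
def meets {P K : ℕ} (A B : KeyRing P K) : Prop := (A.1 ∩ B.1).Nonempty

open Classical in
/-- Probability that a pair with given key rings is not adjacent. -/
noncomputable def nf {P K : ℕ} (α : ℝ) (A B : KeyRing P K) : ℝ := if meets A B then 1 - α else 1

/-- Expectation. -/
noncomputable def Ex (n P K : ℕ) (α : ℝ) (f : (Fin n → KeyRing P K) → (Pairs n → Bool) → ℝ) : ℝ :=
  ∑ κ : Fin n → KeyRing P K, ∑ b : Pairs n → Bool, wt n P K α κ b * f κ b

open Classical in
lemma sum_b {n : ℕ} (α : ℝ) (D : Pairs n → Prop) (ind : (Pairs n → Bool) → ℝ)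
    (hi1 : ∀ b, (∀ e, D e → b e = false) → ind b = 1)
    (hi0 : ∀ b, (¬ ∀ e, D e → b e = false) → ind b = 0) :
    ∑ b : Pairs n → Bool, (∏ e : Pairs n, (if b e then α else 1 - α)) *
      ind b = ∏ e : Pairs n, (if D e then 1 - α else 1) := by
  have h : ∀ b : Pairs n → Bool, (∏ e : Pairs n, (if b e then α else 1 - α)) *
      ind b =
      ∏ e : Pairs n, ((if b e then α else 1 - α) * (if D e → b e = false then (1:ℝ) else 0)) := by
    intro b
    rw [Finset.prod_mul_distrib]
    congr 1
    by_cases hb : ∀ e, D e → b e = false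
    · rw [hi1 b hb]; symm; apply Finset.prod_eq_one; intro e _; rw [if_pos (hb e)]
    · rw [hi0 b hb]; push Not at hb; obtain ⟨e, he, he'⟩ := hb
      symm; apply Finset.prod_eq_zero (Finset.mem_univ e); rw [if_neg]; simp [he, he']
  simp_rw [h]
  rw [← Fintype.prod_sum (fun (e : Pairs n) (x : Bool) => ((if x then α else 1 - α) * (if D e → x = false then (1:ℝ) else 0)))]
  apply Finset.prod_congr rfl
  intro e _
  by_cases hD : D e <;> simp [hD]

lemma prod_pairs {n : ℕ} (i : Fin n) (g : Fin n → ℝ) :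
    ∏ e : Pairs n, ((if e.1.1 = i then g e.1.2 else 1) * (if e.1.2 = i then g e.1.1 else 1)) =
      ∏ k : Fin n, (if k = i then 1 else g k) := by
  have := Finset.prod_subtype (F := inferInstance) (p := fun e : Fin n × Fin n => e.1 < e.2)
    (Finset.univ.filter (fun e : Fin n × Fin n => e.1 < e.2)) (by simp)
    (fun e => ((if e.1 = i then g e.2 else 1) * (if e.2 = i then g e.1 else 1)))
  rw [← this, Finset.prod_mul_distrib, Finset.prod_filter, Finset.prod_filter,
    Fintype.prod_prod_type, Fintype.prod_prod_type_right]
  have h1 : ∀ a : Fin n, ∏ y : Fin n, (if a < y then (if a = i then g y else 1) else 1) =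
     if a = i then ∏ y : Fin n, (if i < y then g y else 1) else 1 := by
    intro a; by_cases ha : a = i
    · subst ha; simp
    · simp [ha]
  have h2 : ∀ a : Fin n, ∏ y : Fin n, (if y < a then (if a = i then g y else 1) else 1) =
     if a = i then ∏ y : Fin n, (if y < i then g y else 1) else 1 := by
    intro a; by_cases ha : a = i
    · subst ha; simp
    · simp [ha]
  simp only [h1, h2, Finset.prod_ite_eq', Finset.mem_univ, if_true]
  rw [← Finset.prod_mul_distrib]
  apply Finset.prod_congr rfl
  intro k _
  rcases lt_trichotomy k i with h | h | h
  · simp [h, h.ne, h.le]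
  · simp [h]
  · simp [h, h.ne', h.le]

lemma isolated_iff {n P K : ℕ} (κ : Fin n → KeyRing P K) (b : Pairs n → Bool) (i : Fin n) :
    Isolated κ b i ↔ ∀ e : Pairs n, ((e.1.1 = i ∨ e.1.2 = i) ∧ meets (κ e.1.1) (κ e.1.2)) → b e = false := by
  constructor
  · rintro h ⟨⟨x, y⟩, hxy⟩ ⟨h1, h2⟩
    simp only at h1 h2 hxy
    rcases h1 with rfl | rfl
    · have := h y
      by_contra hb
      exact this ⟨hxy.ne, h2, by simpa [link, hxy] using hb⟩
    · have := h x
      by_contra hb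
      refine this ⟨hxy.ne', by rw [Finset.inter_comm]; exact h2, by simpa [link, hxy, hxy.not_gt] using hb⟩
  · rintro h j ⟨hij, hm, hl⟩
    rcases lt_or_gt_of_ne hij with h' | h'
    · have := h ⟨(i, j), h'⟩ ⟨Or.inl rfl, hm⟩
      simp [link, h', this] at hl
    · have := h ⟨(j, i), h'⟩ ⟨Or.inr rfl, by rw [meets, Finset.inter_comm]; exact hm⟩
      simp [link, h', not_lt_of_gt h', this] at hl

lemma nf_comm {P K : ℕ} (α : ℝ) (A B : KeyRing P K) : nf α A B = nf α B A := by
  have h : meets A B ↔ meets B A := by rw [meets, meets, Finset.inter_comm]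
  by_cases h' : meets A B
  · rw [nf, nf, if_pos h', if_pos (h.1 h')]
  · rw [nf, nf, if_neg h', if_neg (fun x => h' (h.2 x))]

open Classical in
lemma sum_b_one {n P K : ℕ} (α : ℝ) (κ : Fin n → KeyRing P K) (i : Fin n) :
    ∑ b : Pairs n → Bool, wt n P K α κ b * (if Isolated κ b i then (1:ℝ) else 0) =
      (numKR P K)⁻¹ ^ n * ∏ k : Fin n, (if k = i then 1 else nf α (κ i) (κ k)) := by
  simp_rw [wt, mul_assoc]
  rw [← Finset.mul_sum]
  congr 1
  have := sum_b α (fun e : Pairs n => (e.1.1 = i ∨ e.1.2 = i) ∧ meets (κ e.1.1) (κ e.1.2))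
    (fun b => if Isolated κ b i then 1 else 0)
    (fun b hb => if_pos ((isolated_iff κ b i).2 hb)) (fun b hb => if_neg (fun h => hb ((isolated_iff κ b i).1 h)))
  rw [← prod_pairs i (fun k => nf α (κ i) (κ k))]
  refine this.trans ?_
  apply Finset.prod_congr rfl
  rintro ⟨⟨x, y⟩, hxy⟩ _
  simp only at hxy ⊢
  by_cases hx : x = i
  · subst hx
    simp [hxy.ne', nf]
  · by_cases hy : y = i
    · subst hy
      simp only [hx, nf_comm α (κ y) (κ x)]; simp [nf]
    · simp [hx, hy]

open Classical in
lemma sum_b_two {n P K : ℕ} (hK : K ≤ P) (α : ℝ) (h0 : 0 ≤ α) (h1 : α ≤ 1)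
    (κ : Fin n → KeyRing P K) (i j : Fin n) (hij : i ≠ j) :
    ∑ b : Pairs n → Bool, wt n P K α κ b *
      ((if Isolated κ b i then (1:ℝ) else 0) * (if Isolated κ b j then (1:ℝ) else 0)) ≤
      (numKR P K)⁻¹ ^ n * ∏ k : Fin n, (if k = i then 1 else if k = j then 1 else
        (nf α (κ i) (κ k) * nf α (κ j) (κ k))) := by
  simp_rw [wt, mul_assoc]
  rw [← Finset.mul_sum]
  apply mul_le_mul_of_nonneg_left _ (by rw [numKR]; positivity)
  rw [sum_b α (fun e : Pairs n => ((e.1.1 = i ∨ e.1.2 = i) ∨ (e.1.1 = j ∨ e.1.2 = j)) ∧ meets (κ e.1.1) (κ e.1.2))]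
  rotate_left
  · intro b hb
    rw [if_pos, if_pos, mul_one]
    · rw [isolated_iff]; exact fun e he => hb e ⟨Or.inr he.1, he.2⟩
    · rw [isolated_iff]; exact fun e he => hb e ⟨Or.inl he.1, he.2⟩
  · intro b hb
    by_cases hi : Isolated κ b i
    · by_cases hj : Isolated κ b j
      · exfalso; apply hb
        rw [isolated_iff] at hi hj
        rintro e ⟨h1 | h1, h2⟩
        · exact hi e ⟨h1, h2⟩
        · exact hj e ⟨h1, h2⟩
      · rw [if_neg hj, mul_zero]
    · rw [if_neg hi, zero_mul]
  have e2 : ∀ k, (if k = i then (1:ℝ) else if k = j then 1 else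
        (nf α (κ i) (κ k) * nf α (κ j) (κ k))) =
     (if k = i then 1 else if k = j then 1 else nf α (κ i) (κ k)) *
     (if k = j then 1 else if k = i then 1 else nf α (κ j) (κ k)) := by
    intro k; split_ifs <;> simp
  simp_rw [e2]
  rw [Finset.prod_mul_distrib, ← prod_pairs i (fun k => if k = j then 1 else nf α (κ i) (κ k)),
    ← prod_pairs j (fun k => if k = i then 1 else nf α (κ j) (κ k)), ← Finset.prod_mul_distrib]
  apply Finset.prod_le_prod
  · intro e _; split_ifs <;> linarith
  rintro ⟨⟨x, y⟩, hxy⟩ _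
  simp only at hxy ⊢
  have hne := hxy.ne
  have hle : (if meets (κ x) (κ y) then 1 - α else 1) ≤ 1 := by split_ifs <;> linarith
  by_cases hx : x = i
  · subst hx
    by_cases hy : y = j
    · subst hy
      simp [hne, hne.symm, hle]
    · simp [hy, hne.symm, hij, nf]
  · by_cases hx' : x = j
    · subst hx'
      by_cases hy : y = i
      · subst hy
        simp [hne, hne.symm, hle]
      · simp [hy, hne.symm, hx, nf]
    · by_cases hy : y = i
      · subst hy
        simp [hx, hx', hij, nf, meets, Finset.inter_comm]
      · by_cases hy' : y = j
        · subst hy'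
          simp [hx, hx', hy, nf, meets, Finset.inter_comm]
        · simp [hx, hx', hy, hy']

lemma numKR_pos {P K : ℕ} (hK : K ≤ P) : 0 < numKR P K := by
  rw [numKR]; exact_mod_cast Nat.choose_pos hK

lemma card_KR (P K : ℕ) : (Fintype.card (KeyRing P K) : ℝ) = numKR P K := by
  rw [numKR, Fintype.card_finset_len, Fintype.card_fin]

lemma Ex_one {n P K : ℕ} (hK : K ≤ P) (α : ℝ) : Ex n P K α (fun _ _ => 1) = 1 := by
  have := sum_b (n := n) α (fun _ => False) (fun _ => 1) (by simp) (by simp)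
  simp only [mul_one, if_false, Finset.prod_const_one] at this
  simp only [Ex, wt, mul_one, ← Finset.mul_sum, this, Finset.sum_const, Finset.card_univ, nsmul_eq_mul]
  rw [Fintype.card_fun, Fintype.card_fin, Nat.cast_pow, card_KR, ← mul_pow,
    mul_inv_cancel₀ (numKR_pos hK).ne', one_pow]

open Classical in
lemma Ex_iso {n P K : ℕ} (α : ℝ) (s : ℝ) (hK : K ≤ P)
    (hs : ∀ A : KeyRing P K, ∑ S, nf α A S = numKR P K * s) (i : Fin n) :
    Ex n P K α (fun κ b => if Isolated κ b i then 1 else 0) = s ^ (n-1) := by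
  have hN := (numKR_pos hK).ne'
  unfold Ex
  simp_rw [sum_b_one]
  rw [← Finset.mul_sum]
  have : ∀ κ : Fin n → KeyRing P K, ∏ k : Fin n, (if k = i then 1 else nf α (κ i) (κ k)) =
      ∑ A : KeyRing P K, ∏ k : Fin n, (if k = i then (if κ k = A then 1 else 0) else nf α A (κ k)) := by
    intro κ
    rw [Finset.sum_eq_single (κ i)]
    · apply Finset.prod_congr rfl
      intro k _
      by_cases hk : k = i
      · subst hk; simp
      · simp [hk]
    · intro A _ hA
      apply Finset.prod_eq_zero (Finset.mem_univ i)
      simp [hA.symm]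
    · simp
  simp_rw [this]
  rw [Finset.sum_comm]
  have h2 : ∀ A : KeyRing P K, ∑ κ : Fin n → KeyRing P K, ∏ k : Fin n, (if k = i then (if κ k = A then 1 else 0) else nf α A (κ k)) = (numKR P K * s) ^ (n-1) := by
    intro A
    rw [← Fintype.prod_sum (fun (k : Fin n) (S : KeyRing P K) => (if k = i then (if S = A then 1 else 0) else nf α A S))]
    rw [← Finset.mul_prod_erase _ _ (Finset.mem_univ i)]
    rw [Finset.prod_congr rfl (g := fun _ => numKR P K * s)]
    · simp
    · intro k hk
      simp [Finset.ne_of_mem_erase hk, hs]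
  simp_rw [h2]
  rw [Finset.sum_const, Finset.card_univ, nsmul_eq_mul, card_KR]
  obtain ⟨m, rfl⟩ : ∃ m, n = m + 1 := ⟨n - 1, by have := i.pos; omega⟩
  simp only [Nat.add_sub_cancel]
  rw [pow_succ, mul_pow]
  have h3 : (numKR P K)⁻¹ ^ m * numKR P K ^ m = 1 := by rw [← mul_pow, inv_mul_cancel₀ hN, one_pow]
  calc _ = ((numKR P K)⁻¹ ^ m * numKR P K ^ m) * ((numKR P K)⁻¹ * numKR P K) * s ^ m := by ring
    _ = _ := by rw [h3, inv_mul_cancel₀ hN]; ring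

open Classical in
lemma Ex_iso2 {n P K : ℕ} (α : ℝ) (h0 : 0 ≤ α) (h1 : α ≤ 1) (hK : K ≤ P) (i j : Fin n) (hij : i ≠ j) :
    Ex n P K α (fun κ b => (if Isolated κ b i then 1 else 0) * (if Isolated κ b j then 1 else 0)) ≤
      (numKR P K)⁻¹ ^ 2 * ∑ A : KeyRing P K, ∑ B : KeyRing P K,
        ((numKR P K)⁻¹ * ∑ S, nf α A S * nf α B S) ^ (n-2) := by
  have hN := (numKR_pos hK).ne'
  unfold Ex
  refine (Finset.sum_le_sum fun κ _ => sum_b_two hK α h0 h1 κ i j hij).trans ?_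
  rw [← Finset.mul_sum]
  have : ∀ κ : Fin n → KeyRing P K, ∏ k : Fin n, (if k = i then (1:ℝ) else if k = j then 1 else
        (nf α (κ i) (κ k) * nf α (κ j) (κ k))) =
      ∑ A : KeyRing P K, ∑ B : KeyRing P K, ∏ k : Fin n, (if k = i then (if κ k = A then 1 else 0) else
        if k = j then (if κ k = B then 1 else 0) else nf α A (κ k) * nf α B (κ k)) := by
    intro κ
    rw [Finset.sum_eq_single (κ i), Finset.sum_eq_single (κ j)]
    · apply Finset.prod_congr rfl
      intro k _
      by_cases hk : k = i
      · subst hk; simp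
      · by_cases hk' : k = j
        · subst hk'; simp [hk]
        · simp [hk, hk']
    · intro A _ hA
      apply Finset.prod_eq_zero (Finset.mem_univ j)
      simp [hA.symm, hij.symm]
    · simp
    · intro A _ hA
      apply Finset.sum_eq_zero
      intro B _
      apply Finset.prod_eq_zero (Finset.mem_univ i)
      simp [hA.symm]
    · simp
  simp_rw [this]
  rw [Finset.sum_comm]
  have h2 : ∀ A B : KeyRing P K, ∑ κ : Fin n → KeyRing P K, ∏ k : Fin n, (if k = i then (if κ k = A then 1 else 0) else
        if k = j then (if κ k = B then 1 else 0) else nf α A (κ k) * nf α B (κ k)) = (∑ S, nf α A S * nf α B S) ^ (n-2) := by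
    intro A B
    rw [← Fintype.prod_sum (fun (k : Fin n) (S : KeyRing P K) => (if k = i then (if S = A then 1 else 0) else
        if k = j then (if S = B then 1 else 0) else nf α A S * nf α B S))]
    have hj : j ∈ Finset.univ.erase i := by simp [hij.symm]
    rw [← Finset.mul_prod_erase _ _ (Finset.mem_univ i), ← Finset.mul_prod_erase _ _ hj]
    rw [Finset.prod_congr rfl (g := fun _ => (∑ S, nf α A S * nf α B S))]
    · simp [hij.symm, Finset.card_erase_of_mem hj]
      congr 1
    · intro k hk
      simp only [Finset.mem_erase] at hk
      simp [hk.1, hk.2.1]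
  simp_rw [Finset.sum_comm (s := (Finset.univ : Finset (Fin n → KeyRing P K)))]
  simp_rw [h2]
  obtain ⟨m, rfl⟩ : ∃ m, n = m + 2 := ⟨n - 2, by have := i.2; have := j.2; have : i.1 ≠ j.1 := fun h => hij (Fin.ext h); omega⟩
  simp only [Nat.add_sub_cancel]
  simp_rw [mul_pow, ← Finset.mul_sum]
  rw [← mul_assoc, ← pow_add, Nat.add_comm 2 m]

lemma q_eq {K P : ℕ} (hKP : K < P) : q K P = ((P - K).choose K : ℝ) / numKR P K := by
  rw [q, numKR]
  split_ifs with h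
  · rfl
  · rw [Nat.choose_eq_zero_of_lt (by omega)]; simp

lemma sum_disj {P K : ℕ} (T : Finset (Fin P)) :
    ∑ S : KeyRing P K, (if Disjoint T S.1 then (1:ℝ) else 0) = ((P - T.card).choose K : ℝ) := by
  have := Finset.sum_subtype (F := inferInstance) (p := fun S : Finset (Fin P) => S.card = K)
    (Finset.univ.filter (fun S : Finset (Fin P) => S.card = K)) (by simp)
    (fun S => (if Disjoint T S then (1:ℝ) else 0))
  rw [← this, Finset.sum_boole]
  have h : (Finset.univ.filter (fun S : Finset (Fin P) => S.card = K)).filter (fun S => Disjoint T S)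
      = Finset.powersetCard K Tᶜ := by
    ext S
    simp only [Finset.mem_filter, Finset.mem_univ, true_and, Finset.mem_powersetCard]
    rw [and_comm, Finset.subset_compl_iff_disjoint_left]
  rw [h, Finset.card_powersetCard, Finset.card_compl, Fintype.card_fin]

lemma nf_eq {P K : ℕ} (α : ℝ) (A S : KeyRing P K) :
    nf α A S = 1 - α + α * (if Disjoint A.1 S.1 then (1:ℝ) else 0) := by
  rw [nf]
  by_cases h : Disjoint A.1 S.1
  · rw [if_neg, if_pos h]; · ring
    rw [meets, Finset.not_nonempty_iff_eq_empty]; exact Finset.disjoint_iff_inter_eq_empty.1 h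
  · rw [if_pos, if_neg h]; · ring
    rw [meets, Finset.nonempty_iff_ne_empty]; exact fun h' => h (Finset.disjoint_iff_inter_eq_empty.2 h')

lemma sum_nf {P K : ℕ} (hKP : K < P) (α : ℝ) (A : KeyRing P K) :
    ∑ S, nf α A S = numKR P K * (1 - α * (1 - q K P)) := by
  have hN := (numKR_pos hKP.le).ne'
  simp_rw [nf_eq]
  rw [Finset.sum_add_distrib, ← Finset.mul_sum, sum_disj, A.2, Finset.sum_const, Finset.card_univ,
    nsmul_eq_mul, card_KR, q_eq hKP]
  field_simp
  ring

lemma choose_logconc {P K : ℕ} (h : 2 * K ≤ P) :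
    (P - 2 * K).choose K * P.choose K ≤ (P - K).choose K ^ 2 := by
  have key : (P - 2 * K).descFactorial K * P.descFactorial K ≤ (P - K).descFactorial K ^ 2 := by
    rw [Nat.descFactorial_eq_prod_range, Nat.descFactorial_eq_prod_range, Nat.descFactorial_eq_prod_range,
      ← Finset.prod_mul_distrib, ← Finset.prod_pow]
    apply Finset.prod_le_prod' 
    intro x hx
    by_cases h3 : 2 * K + x ≤ P
    · obtain ⟨m, rfl⟩ := Nat.exists_eq_add_of_le h3
      have e1 : 2 * K + x + m - 2 * K - x = m := by omega
      have e2 : 2 * K + x + m - x = m + 2 * K := by omega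
      have e3 : 2 * K + x + m - K - x = m + K := by omega
      rw [e1, e2, e3]; nlinarith
    · have : P - 2 * K - x = 0 := by omega
      rw [this]; simp
  rw [Nat.descFactorial_eq_factorial_mul_choose, Nat.descFactorial_eq_factorial_mul_choose,
    Nat.descFactorial_eq_factorial_mul_choose] at key
  have hf : 0 < K.factorial ^ 2 := by positivity
  refine Nat.le_of_mul_le_mul_left ?_ hf
  calc _ = (K.factorial * (P - 2 * K).choose K) * (K.factorial * P.choose K) := by ring
    _ ≤ _ := key
    _ = _ := by ring

lemma mean_nf2 {P K : ℕ} (hKP : K < P) (α : ℝ) (A B : KeyRing P K) :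
    (numKR P K)⁻¹ * ∑ S, nf α A S * nf α B S = (1-α)^2 + 2 * α * (1-α) * q K P +
      α^2 * ((numKR P K)⁻¹ * ∑ S : KeyRing P K, (if Disjoint (A.1 ∪ B.1) S.1 then (1:ℝ) else 0)) := by
  have hN := (numKR_pos hKP.le).ne'
  have : ∀ S : KeyRing P K, nf α A S * nf α B S = (1-α)^2 +
     (α * (1-α)) * (if Disjoint A.1 S.1 then (1:ℝ) else 0) + (α * (1-α)) * (if Disjoint B.1 S.1 then (1:ℝ) else 0)
      + α^2 * (if Disjoint (A.1 ∪ B.1) S.1 then (1:ℝ) else 0) := by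
    intro S
    rw [nf_eq, nf_eq]
    by_cases h1 : Disjoint A.1 S.1 <;> by_cases h2 : Disjoint B.1 S.1 <;> simp [h1, h2, Finset.disjoint_union_left] <;> ring
  simp_rw [this, Finset.sum_add_distrib, ← Finset.mul_sum]
  rw [sum_disj A.1, sum_disj B.1, A.2, B.2, Finset.sum_const, Finset.card_univ, nsmul_eq_mul, card_KR, q_eq hKP]
  field_simp
  ring

lemma q_nonneg {K P : ℕ} : 0 ≤ q K P := by
  rw [q]; split_ifs <;> positivity

lemma q_le_one {K P : ℕ} (hKP : K < P) : q K P ≤ 1 := by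
  rw [q_eq hKP, div_le_one (numKR_pos hKP.le), numKR]
  exact_mod_cast Nat.choose_le_choose K (Nat.sub_le P K)

lemma mean_le {P K : ℕ} (hKP : K < P) (α : ℝ) (A B : KeyRing P K) :
    (numKR P K)⁻¹ * ∑ S, nf α A S * nf α B S ≤ 1 - 2 * (α * (1 - q K P)) + α^2 * (1 - q K P) := by
  have hN := (numKR_pos hKP.le)
  rw [mean_nf2 hKP]
  have : (numKR P K)⁻¹ * ∑ S : KeyRing P K, (if Disjoint (A.1 ∪ B.1) S.1 then (1:ℝ) else 0) ≤ q K P := by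
    rw [q_eq hKP, div_eq_inv_mul]
    apply mul_le_mul_of_nonneg_left _ (inv_nonneg.2 hN.le)
    rw [sum_disj]
    have : K ≤ (A.1 ∪ B.1).card := by
      conv_lhs => rw [← A.2]
      exact Finset.card_le_card Finset.subset_union_left
    exact_mod_cast Nat.choose_le_choose K (by omega)
  nlinarith [mul_le_mul_of_nonneg_left this (sq_nonneg α)]

lemma mean_le_disj {P K : ℕ} (hKP : K < P) (α : ℝ) (A B : KeyRing P K) (hAB : Disjoint A.1 B.1) :
    (numKR P K)⁻¹ * ∑ S, nf α A S * nf α B S ≤ (1 - α * (1 - q K P))^2 := by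
  have hN := (numKR_pos hKP.le)
  rw [mean_nf2 hKP]
  have : (numKR P K)⁻¹ * ∑ S : KeyRing P K, (if Disjoint (A.1 ∪ B.1) S.1 then (1:ℝ) else 0) ≤ q K P ^ 2 := by
    have hc : (A.1 ∪ B.1).card = 2 * K := by
      rw [Finset.card_union_of_disjoint hAB, A.2, B.2]; ring
    have h2 : 2 * K ≤ P := by
      rw [← hc]; simpa using Finset.card_le_univ (A.1 ∪ B.1)
    rw [q_eq hKP, sum_disj, hc, div_pow, ← div_eq_inv_mul, div_le_div_iff₀ hN (by positivity)]
    have := choose_logconc h2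
    have h3 : ((P - 2 * K).choose K : ℝ) * numKR P K ≤ ((P - K).choose K : ℝ) ^ 2 := by
      rw [numKR]; exact_mod_cast this
    nlinarith [mul_le_mul_of_nonneg_right h3 hN.le]
  nlinarith [mul_le_mul_of_nonneg_left this (sq_nonneg α)]

lemma mean_nonneg {P K : ℕ} (hKP : K < P) (α : ℝ) (h1 : α ≤ 1) (A B : KeyRing P K) :
    0 ≤ (numKR P K)⁻¹ * ∑ S, nf α A S * nf α B S := by
  have hN := (numKR_pos hKP.le)
  have : ∀ A S : KeyRing P K, 0 ≤ nf α A S := by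
    intro A S; rw [nf]; split_ifs <;> linarith
  exact mul_nonneg (inv_nonneg.2 hN.le) (Finset.sum_nonneg fun S _ => mul_nonneg (this _ _) (this _ _))

open Classical in
lemma Ex_iso2' {n P K : ℕ} (α : ℝ) (h0 : 0 ≤ α) (h1 : α ≤ 1) (hKP : K < P) (i j : Fin n) (hij : i ≠ j) :
    Ex n P K α (fun κ b => (if Isolated κ b i then 1 else 0) * (if Isolated κ b j then 1 else 0)) ≤
      q K P * ((1 - α * (1 - q K P))^2)^(n-2) +
        (1 - q K P) * (1 - 2 * (α * (1 - q K P)) + α^2 * (1 - q K P))^(n-2) := by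
  have hN := (numKR_pos hKP.le)
  refine (Ex_iso2 α h0 h1 hKP.le i j hij).trans ?_
  set X := ((1 - α * (1 - q K P))^2)^(n-2) with hX
  set Y := (1 - 2 * (α * (1 - q K P)) + α^2 * (1 - q K P))^(n-2) with hY
  have hb : ∀ A B : KeyRing P K, ((numKR P K)⁻¹ * ∑ S, nf α A S * nf α B S) ^ (n-2) ≤
      Y + (X - Y) * (if Disjoint A.1 B.1 then (1:ℝ) else 0) := by
    intro A B
    split_ifs with h
    · have := pow_le_pow_left₀ (mean_nonneg hKP α h1 A B) (mean_le_disj hKP α A B h) (n-2)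
      linarith
    · have := pow_le_pow_left₀ (mean_nonneg hKP α h1 A B) (mean_le hKP α A B) (n-2)
      linarith
  have hs : ∑ A : KeyRing P K, ∑ B : KeyRing P K, ((numKR P K)⁻¹ * ∑ S, nf α A S * nf α B S) ^ (n-2)
      ≤ numKR P K * (numKR P K * Y + (X - Y) * (numKR P K * q K P)) := by
    calc _ ≤ ∑ A : KeyRing P K, ∑ B : KeyRing P K, (Y + (X - Y) * (if Disjoint A.1 B.1 then (1:ℝ) else 0)) :=
          Finset.sum_le_sum fun A _ => Finset.sum_le_sum fun B _ => hb A B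
      _ = ∑ A : KeyRing P K, (numKR P K * Y + (X - Y) * (numKR P K * q K P)) := by
          apply Finset.sum_congr rfl
          intro A _
          rw [Finset.sum_add_distrib, ← Finset.mul_sum, sum_disj A.1, A.2, Finset.sum_const, Finset.card_univ,
            nsmul_eq_mul, card_KR, q_eq hKP]
          field_simp
      _ = _ := by rw [Finset.sum_const, Finset.card_univ, nsmul_eq_mul, card_KR]
  calc _ ≤ (numKR P K)⁻¹ ^ 2 * (numKR P K * (numKR P K * Y + (X - Y) * (numKR P K * q K P))) :=
        mul_le_mul_of_nonneg_left hs (by positivity)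
    _ = _ := by field_simp; ring

lemma wt_nonneg {n P K : ℕ} (α : ℝ) (h0 : 0 ≤ α) (h1 : α ≤ 1) (κ : Fin n → KeyRing P K) (b : Pairs n → Bool) :
    0 ≤ wt n P K α κ b := by
  rw [wt]
  apply mul_nonneg
  · rw [numKR]; positivity
  · apply Finset.prod_nonneg; intro e _; split_ifs <;> linarith

lemma Ex_mono {n P K : ℕ} (α : ℝ) (h0 : 0 ≤ α) (h1 : α ≤ 1)
    {f g : (Fin n → KeyRing P K) → (Pairs n → Bool) → ℝ} (h : ∀ κ b, f κ b ≤ g κ b) :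
    Ex n P K α f ≤ Ex n P K α g :=
  Finset.sum_le_sum fun κ _ => Finset.sum_le_sum fun b _ =>
    mul_le_mul_of_nonneg_left (h κ b) (wt_nonneg α h0 h1 κ b)

lemma Ex_add {n P K : ℕ} (α : ℝ) (f g : (Fin n → KeyRing P K) → (Pairs n → Bool) → ℝ) :
    Ex n P K α (fun κ b => f κ b + g κ b) = Ex n P K α f + Ex n P K α g := by
  simp only [Ex, mul_add, Finset.sum_add_distrib]

lemma Ex_smul {n P K : ℕ} (α c : ℝ) (f : (Fin n → KeyRing P K) → (Pairs n → Bool) → ℝ) :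
    Ex n P K α (fun κ b => c * f κ b) = c * Ex n P K α f := by
  simp only [Ex, Finset.mul_sum]
  refine Finset.sum_congr rfl fun κ _ => Finset.sum_congr rfl fun b _ => by ring

lemma Ex_sum {n P K : ℕ} {ι : Type} (s : Finset ι) (α : ℝ) (f : ι → (Fin n → KeyRing P K) → (Pairs n → Bool) → ℝ) :
    Ex n P K α (fun κ b => ∑ i ∈ s, f i κ b) = ∑ i ∈ s, Ex n P K α (f i) := by
  classical
  induction s using Finset.induction_on with
  | empty => simp [Ex]
  | insert a s ha ih =>
    simp only [Finset.sum_insert ha]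
    rw [Ex_add, ih]

open Classical in
/-- Number of isolated nodes as a real. -/
noncomputable def Ic {n P K : ℕ} (κ : Fin n → KeyRing P K) (b : Pairs n → Bool) : ℝ :=
  ∑ i : Fin n, (if Isolated κ b i then (1:ℝ) else 0)

lemma prob_eq {n P K : ℕ} (α : ℝ) : probNoIsolated n P K α =
   Ex n P K α (fun κ b => if ∀ i, ¬ Isolated κ b i then 1 else 0) := rfl

lemma prob_nonneg {n P K : ℕ} (α : ℝ) (h0 : 0 ≤ α) (h1 : α ≤ 1) : 0 ≤ probNoIsolated n P K α := by
  refine Finset.sum_nonneg fun κ _ => Finset.sum_nonneg fun b _ =>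
    mul_nonneg (wt_nonneg α h0 h1 κ b) ?_
  split_ifs <;> norm_num

lemma prob_le_one {n P K : ℕ} (hKP : K < P) (α : ℝ) (h0 : 0 ≤ α) (h1 : α ≤ 1) : probNoIsolated n P K α ≤ 1 := by
  rw [← Ex_one (n := n) hKP.le α, prob_eq]
  apply Ex_mono α h0 h1
  intro κ b
  split_ifs <;> norm_num

lemma Ex_Ic {n P K : ℕ} (hKP : K < P) (α : ℝ) :
    Ex n P K α Ic = n * (1 - α * (1 - q K P))^(n-1) := by
  unfold Ic
  rw [Ex_sum Finset.univ α]
  simp_rw [Ex_iso α _ hKP.le (sum_nf hKP α)]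
  simp

lemma Ic_nonneg {n P K : ℕ} (κ : Fin n → KeyRing P K) (b : Pairs n → Bool) : 0 ≤ Ic κ b :=
  Finset.sum_nonneg fun i _ => by split_ifs <;> norm_num

lemma prob_ge {n P K : ℕ} (hKP : K < P) (α : ℝ) (h0 : 0 ≤ α) (h1 : α ≤ 1) :
    1 - n * (1 - α * (1 - q K P))^(n-1) ≤ probNoIsolated n P K α := by
  rw [← Ex_Ic hKP, sub_le_iff_le_add, prob_eq, ← Ex_add]
  refine (Ex_one (n := n) hKP.le α).symm.le.trans ?_
  apply Ex_mono α h0 h1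
  intro κ b
  split_ifs with h
  · linarith [Ic_nonneg κ b]
  · push Not at h
    obtain ⟨i, hi⟩ := h
    have : (1:ℝ) ≤ Ic κ b := by
      classical
      rw [Ic]
      have := Finset.single_le_sum (f := fun i => if Isolated κ b i then (1:ℝ) else 0) (fun i _ => by split_ifs <;> norm_num) (Finset.mem_univ i)
      rw [if_pos hi] at this
      convert this
    linarith

lemma Ex_Ic2 {n P K : ℕ} (hKP : K < P) (α : ℝ) (h0 : 0 ≤ α) (h1 : α ≤ 1) (Q : ℝ) (hQ0 : 0 ≤ Q)
    (hQ : q K P * ((1 - α * (1 - q K P))^2)^(n-2) +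
        (1 - q K P) * (1 - 2 * (α * (1 - q K P)) + α^2 * (1 - q K P))^(n-2) ≤ Q) :
    Ex n P K α (fun κ b => Ic κ b ^ 2) ≤ n * (1 - α * (1 - q K P))^(n-1) + n^2 * Q := by
  classical
  have e : Ex n P K α (fun κ b => Ic κ b ^ 2) = ∑ i : Fin n, ∑ j : Fin n,
      Ex n P K α (fun κ b => (if Isolated κ b i then 1 else 0) * (if Isolated κ b j then 1 else 0)) := by
    simp_rw [← Ex_sum, Ic, sq, Finset.sum_mul_sum]
  rw [e]
  have hb : ∀ i j : Fin n, Ex n P K α (fun κ b => (if Isolated κ b i then 1 else 0) * (if Isolated κ b j then 1 else 0))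
     ≤ (if i = j then (1 - α * (1 - q K P))^(n-1) else 0) + Q := by
    intro i j
    by_cases h : i = j
    · subst h
      rw [if_pos rfl, ← Ex_iso α _ hKP.le (sum_nf hKP α) i]
      refine le_trans (Ex_mono α h0 h1 (fun κ b => ?_)) (le_add_of_nonneg_right hQ0)
      split_ifs <;> norm_num
    · rw [if_neg h, zero_add]
      refine le_trans ?_ ((Ex_iso2' α h0 h1 hKP i j h).trans hQ)
      apply le_of_eq; congr!
  refine (Finset.sum_le_sum fun i _ => Finset.sum_le_sum fun j _ => hb i j).trans ?_
  simp [Finset.sum_add_distrib]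
  apply le_of_eq; ring

lemma cheb {n P K : ℕ} (hKP : K < P) (α : ℝ) (h0 : 0 ≤ α) (h1 : α ≤ 1) (Q : ℝ) (hQ0 : 0 ≤ Q)
    (hQ : q K P * ((1 - α * (1 - q K P))^2)^(n-2) +
        (1 - q K P) * (1 - 2 * (α * (1 - q K P)) + α^2 * (1 - q K P))^(n-2) ≤ Q) :
    (n * (1 - α * (1 - q K P))^(n-1))^2 * probNoIsolated n P K α ≤
      n * (1 - α * (1 - q K P))^(n-1) + n^2 * Q - (n * (1 - α * (1 - q K P))^(n-1))^2 := by
  have h2 := Ex_Ic2 hKP α h0 h1 Q hQ0 hQ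
  have hm := Ex_Ic (n := n) hKP α
  set m := n * (1 - α * (1 - q K P))^(n-1) with hmdef
  have h3 : m ^ 2 * probNoIsolated n P K α + (2 * m) * Ex n P K α Ic ≤
      Ex n P K α (fun κ b => Ic κ b ^ 2) + m ^ 2 * Ex n P K α (fun _ _ => 1) := by
    rw [prob_eq, ← Ex_smul, ← Ex_smul, ← Ex_smul, ← Ex_add, ← Ex_add]
    apply Ex_mono α h0 h1
    intro κ b
    split_ifs with h
    · have : Ic κ b = 0 := by
        rw [Ic]; apply Finset.sum_eq_zero; intro i _; rw [if_neg (h i)]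
      rw [this]; linarith
    · nlinarith [sq_nonneg (Ic κ b - m)]
  rw [Ex_one hKP.le, hm] at h3
  nlinarith

lemma prob_le_bound {n P K : ℕ} (hn : 2 ≤ n) (hKP : K < P) (α : ℝ) (h0 : 0 ≤ α) (h1 : α ≤ 1) (t : ℝ)
    (ht : α * (1 - q K P) = t) (ht1 : t < 1) :
    probNoIsolated n P K α ≤ Real.exp (n * t / (1 - t)^2) / n +
      (1 + (n * t) * (Real.exp (n * t / (1 - t)^2) / n)) / (1 - t)^2 - 1 := by
  have hq0 := q_nonneg (K := K) (P := P)
  have hq1 := q_le_one hKP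
  have ht0 : 0 ≤ t := by rw [← ht]; exact mul_nonneg h0 (by linarith)
  set s := 1 - t with hs
  have hs0 : 0 < s := by linarith
  have hs1 : s ≤ 1 := by linarith
  set L := n * t / s^2 with hL
  have hnR : (0:ℝ) < n := by exact_mod_cast (by omega : 0 < n)
  have hL0 : 0 ≤ L := by positivity
  have hQ : q K P * ((1 - α * (1 - q K P))^2)^(n-2) +
        (1 - q K P) * (1 - 2 * (α * (1 - q K P)) + α^2 * (1 - q K P))^(n-2) ≤
        (s^2)^(n-2) * (1 + t * Real.exp L) := by
    have e1 : α^2 * (1 - q K P) = α * t := by rw [← ht]; ring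
    rw [ht, ← hs, e1]
    have hY : (1 - 2 * t + α * t) ^ (n-2) ≤ (s^2)^(n-2) * (1 + α * Real.exp L) := by
      have a1 : 1 - 2 * t + α * t ≤ s^2 * Real.exp (α * t / s^2) := by
        have := Real.add_one_le_exp (α * t / s^2)
        calc 1 - 2 * t + α * t ≤ s^2 + α * t := by rw [hs]; nlinarith
          _ = s^2 * (α * t / s^2 + 1) := by field_simp; ring
          _ ≤ _ := mul_le_mul_of_nonneg_left this (by positivity)
      have a0 : 0 ≤ 1 - 2 * t + α * t := by
        have : 0 ≤ α * t - t ^ 2 := by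
          have : t ≤ α := by rw [← ht]; nlinarith
          nlinarith
        nlinarith [sq_nonneg (1 - t)]
      refine (pow_le_pow_left₀ a0 a1 (n-2)).trans ?_
      rw [mul_pow, ← Real.exp_nat_mul]
      apply mul_le_mul_of_nonneg_left _ (by positivity)
      have a2 : ((n - 2 : ℕ) : ℝ) * (α * t / s^2) ≤ α * L := by
        have : ((n - 2 : ℕ) : ℝ) ≤ n := by exact_mod_cast Nat.sub_le n 2
        calc _ ≤ (n:ℝ) * (α * t / s^2) := mul_le_mul_of_nonneg_right this (by positivity)
          _ = _ := by rw [hL]; ring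
      refine (Real.exp_le_exp.2 a2).trans ?_
      have := convexOn_exp.2 (Set.mem_univ (0:ℝ)) (Set.mem_univ L) (by linarith : 0 ≤ 1 - α) h0 (by ring)
      simp only [smul_eq_mul, mul_zero, zero_add, Real.exp_zero, mul_one] at this
      linarith
    calc _ ≤ q K P * (s^2)^(n-2) + (1 - q K P) * ((s^2)^(n-2) * (1 + α * Real.exp L)) := by
          have := mul_le_mul_of_nonneg_left hY (by linarith : 0 ≤ 1 - q K P)
          linarith
      _ = (s^2)^(n-2) * (1 + (α * (1 - q K P)) * Real.exp L) := by ring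
      _ = _ := by rw [ht]
  have hc := cheb hKP α h0 h1 _ (by positivity) hQ
  rw [ht, ← hs] at hc
  obtain ⟨k, rfl⟩ : ∃ k, n = k + 2 := ⟨n - 2, by omega⟩
  have e1 : k + 2 - 1 = k + 1 := rfl
  have e2 : k + 2 - 2 = k := rfl
  rw [e1, e2] at hc
  set N : ℝ := ((k + 2 : ℕ) : ℝ) with hN
  have hm : 0 < N * s^(k+1) := by positivity
  have hc2 : probNoIsolated (k+2) P K α ≤ 1 / (N * s^(k+1)) + (1 + t * Real.exp L) / s^2 - 1 := by
    have : 0 < (N * s^(k+1))^2 := by positivity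
    refine le_of_mul_le_mul_left (hc.trans (le_of_eq ?_)) this
    field_simp
    ring
  have h4 : 1 / (N * s^(k+1)) ≤ Real.exp L / N := by
    have b1 : 1 / s ≤ Real.exp (t / s) := by
      have := Real.add_one_le_exp (t / s)
      have e : t / s + 1 = 1 / s := by field_simp; rw [hs]; ring
      linarith
    have b2 : (1 / s)^(k+1) ≤ Real.exp L := by
      refine (pow_le_pow_left₀ (by positivity) b1 (k+1)).trans ?_
      rw [← Real.exp_nat_mul]
      apply Real.exp_le_exp.2
      have : ((k + 1 : ℕ) : ℝ) ≤ N := by rw [hN]; push_cast; linarith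
      calc _ ≤ N * (t / s) := mul_le_mul_of_nonneg_right this (by positivity)
        _ = N * t / s := by ring
        _ ≤ _ := by
          rw [hL]
          apply div_le_div_of_nonneg_left (by positivity) (by positivity)
          nlinarith
    calc 1 / (N * s^(k+1)) = (1/s)^(k+1) / N := by rw [div_pow, one_pow]; field_simp
      _ ≤ _ := div_le_div_of_nonneg_right b2 hnR.le
  have h5 : N * t * (Real.exp L / N) = t * Real.exp L := by field_simp
  rw [h5]
  linarith

lemma log_cast_tendsto : Tendsto (fun n : ℕ => Real.log n) atTop atTop :=
  Real.tendsto_log_atTop.comp tendsto_natCast_atTop_atTop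

lemma nt_div_log (t : ℕ → ℝ) (c : ℝ) (hc : 0 < c)
    (h : Tendsto (fun n : ℕ => t n / (c * Real.log n / n)) atTop (nhds 1)) :
    Tendsto (fun n : ℕ => n * t n / Real.log n) atTop (nhds c) := by
  have := h.mul_const c
  rw [one_mul] at this
  refine this.congr' ?_
  filter_upwards [eventually_ge_atTop 2] with n hn
  have h1 : (0:ℝ) < n := by exact_mod_cast (by omega : 0 < n)
  have h2 : 0 < Real.log n := Real.log_pos (by exact_mod_cast (by omega : 1 < n))
  field_simp

lemma log_div_n : Tendsto (fun n : ℕ => Real.log n / n) atTop (nhds 0) := by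
  have := (Real.isLittleO_log_id_atTop.tendsto_div_nhds_zero).comp tendsto_natCast_atTop_atTop
  exact this

lemma t_tendsto (t : ℕ → ℝ) (c : ℝ)
    (h : Tendsto (fun n : ℕ => n * t n / Real.log n) atTop (nhds c)) : Tendsto t atTop (nhds 0) := by
  have := h.mul log_div_n
  rw [mul_zero] at this
  refine this.congr' ?_
  filter_upwards [eventually_ge_atTop 2] with n hn
  have h1 : (0:ℝ) < n := by exact_mod_cast (by omega : 0 < n)
  have h2 : 0 < Real.log n := Real.log_pos (by exact_mod_cast (by omega : 1 < n))
  field_simp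

lemma log_exp_small (δ : ℝ) (hδ : 0 < δ) :
    Tendsto (fun n : ℕ => Real.log n * Real.exp (-δ * Real.log n)) atTop (nhds 0) := by
  have h := (Real.tendsto_pow_mul_exp_neg_atTop_nhds_zero 1).comp (log_cast_tendsto.const_mul_atTop hδ)
  have := h.const_mul (δ⁻¹)
  rw [mul_zero] at this
  refine this.congr fun n => ?_
  simp only [Function.comp, pow_one]
  rw [neg_mul]; field_simp

lemma exp_small (δ : ℝ) (hδ : 0 < δ) :
    Tendsto (fun n : ℕ => Real.exp (-δ * Real.log n)) atTop (nhds 0) := by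
  have h := Real.tendsto_exp_neg_atTop_nhds_zero.comp (log_cast_tendsto.const_mul_atTop hδ)
  refine h.congr fun n => ?_
  simp

/-- Theorem 3 (strong zero-one law): if `α_n (1 - q(θ_n)) ∼ c (log n)/n` for some
`c > 0` (ratio of the two sides tends to 1), then `P_n(θ_n,α_n) → 0` when `0 < c < 1`
and `P_n(θ_n,α_n) → 1` when `c > 1`; no assumption on the convergence of `α_n log n`
is required. -/
theorem strongZeroOneLaw
    (K P : ℕ → ℕ) (α : ℕ → ℝ) (c : ℝ) (hc : 0 < c)
    (hK : ∀ n, 0 < K n) (hKP : ∀ n, K n < P n)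
    (hα : ∀ n, 0 ≤ α n ∧ α n ≤ 1)
    (hscal : Tendsto
      (fun n => (α n * (1 - q (K n) (P n))) / (c * Real.log n / n)) atTop (nhds 1)) :
    (c < 1 → Tendsto (fun n => probNoIsolated n (P n) (K n) (α n)) atTop (nhds 0)) ∧
    (1 < c → Tendsto (fun n => probNoIsolated n (P n) (K n) (α n)) atTop (nhds 1)) := by
  set t : ℕ → ℝ := fun n => α n * (1 - q (K n) (P n)) with ht
  have hnt : Tendsto (fun n : ℕ => n * t n / Real.log n) atTop (nhds c) := nt_div_log t c hc hscal
  have ht0 : Tendsto t atTop (nhds 0) := t_tendsto t c hnt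
  have htnn : ∀ n, 0 ≤ t n := fun n => mul_nonneg (hα n).1 (by linarith [q_le_one (hKP n)])
  have htlt : ∀ᶠ n in atTop, t n < 1 := ht0.eventually (gt_mem_nhds one_pos)
  constructor
  · intro hc1
    obtain ⟨d, hd1, hd2⟩ := exists_between hc1
    have hs2 : Tendsto (fun n => (1 - t n)^2) atTop (nhds 1) := by
      have := (ht0.const_sub 1).pow 2
      simpa using this
    have hLt : Tendsto (fun n : ℕ => n * t n / Real.log n / (1 - t n)^2) atTop (nhds c) := by
      have := hnt.div hs2 one_ne_zero
      rw [div_one] at this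
      exact this
    have hLe : ∀ᶠ n : ℕ in atTop, Real.exp (n * t n / (1 - t n)^2) / n ≤ Real.exp (-(1-d) * Real.log n) := by
      filter_upwards [hLt.eventually (gt_mem_nhds hd1), eventually_ge_atTop 2] with n h1 hn
      have hn0 : (0:ℝ) < n := by exact_mod_cast (by omega : 0 < n)
      have h2 : 0 < Real.log n := Real.log_pos (by exact_mod_cast (by omega : 1 < n))
      have h3 : n * t n / (1 - t n)^2 ≤ d * Real.log n := by
        rw [div_right_comm, div_lt_iff₀ h2] at h1
        exact h1.le
      have h4 : Real.exp (-(1-d) * Real.log n) = Real.exp (d * Real.log n) / n := by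
        rw [show -(1-d) * Real.log n = d * Real.log n - Real.log n by ring, Real.exp_sub, Real.exp_log hn0]
      rw [h4]
      exact div_le_div_of_nonneg_right (Real.exp_le_exp.2 h3) hn0.le
    have hA : Tendsto (fun n : ℕ => Real.exp (n * t n / (1 - t n)^2) / n) atTop (nhds 0) :=
      squeeze_zero' (Eventually.of_forall fun n => by positivity) hLe (exp_small (1-d) (by linarith))
    have hB0 : Tendsto (fun n : ℕ => Real.log n * (Real.exp (n * t n / (1 - t n)^2) / n)) atTop (nhds 0) := by
      refine squeeze_zero' ?_ ?_ (log_exp_small (1-d) (by linarith))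
      · exact Eventually.of_forall fun n => mul_nonneg (Real.log_natCast_nonneg n) (by positivity)
      · filter_upwards [hLe] with n h
        exact mul_le_mul_of_nonneg_left h (Real.log_natCast_nonneg n)
    have hB : Tendsto (fun n : ℕ => (n * t n) * (Real.exp (n * t n / (1 - t n)^2) / n)) atTop (nhds 0) := by
      have := hnt.mul hB0
      rw [mul_zero] at this
      refine this.congr' ?_
      filter_upwards [eventually_ge_atTop 2] with n hn
      have h2 : 0 < Real.log n := Real.log_pos (by exact_mod_cast (by omega : 1 < n))
      rw [← mul_assoc, div_mul_cancel₀ _ h2.ne']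
    have hlim := ((hA.add (((hB.const_add 1).div hs2 one_ne_zero))).sub_const 1)
    norm_num at hlim
    refine squeeze_zero' (Eventually.of_forall fun n => prob_nonneg (α n) (hα n).1 (hα n).2) ?_ hlim
    filter_upwards [htlt, eventually_ge_atTop 2] with n h1 hn
    exact prob_le_bound hn (hKP n) (α n) (hα n).1 (hα n).2 (t n) rfl h1
  · intro hc1
    obtain ⟨d, hd1, hd2⟩ := exists_between hc1
    have hm : Tendsto (fun n : ℕ => n * (1 - t n)^(n-1)) atTop (nhds 0) := by
      have hlim := (exp_small (d-1) (by linarith)).const_mul (Real.exp 1)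
      rw [mul_zero] at hlim
      refine squeeze_zero' ?_ ?_ hlim
      · filter_upwards [htlt] with n h1
        have : 0 ≤ 1 - t n := by linarith
        positivity
      · filter_upwards [htlt, hnt.eventually (lt_mem_nhds hd2), eventually_ge_atTop 2] with n h1 h2 hn
        have hn0 : (0:ℝ) < n := by exact_mod_cast (by omega : 0 < n)
        have hl : 0 < Real.log n := Real.log_pos (by exact_mod_cast (by omega : 1 < n))
        rw [lt_div_iff₀ hl] at h2
        have h3 : (1 - t n)^(n-1) ≤ Real.exp (1 - d * Real.log n) := by
          refine (pow_le_pow_left₀ (by linarith) (Real.one_sub_le_exp_neg (t n)) (n-1)).trans ?_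
          rw [← Real.exp_nat_mul]
          apply Real.exp_le_exp.2
          rw [Nat.cast_sub (by omega)]
          push_cast
          linarith
        have h4 : Real.exp 1 * Real.exp (-(d-1) * Real.log n) = n * Real.exp (1 - d * Real.log n) := by
          conv_rhs => rw [← Real.exp_log hn0]
          rw [← Real.exp_add, ← Real.exp_add, Real.exp_log hn0]
          congr 1; ring
        rw [h4]
        exact mul_le_mul_of_nonneg_left h3 hn0.le
    have hlim := hm.const_sub 1
    rw [sub_zero] at hlim
    exact tendsto_of_tendsto_of_tendsto_of_le_of_le hlim tendsto_const_nhds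
      (fun n => prob_ge (hKP n) (α n) (hα n).1 (hα n).2)
      (fun n => prob_le_one (hKP n) (α n) (hα n).1 (hα n).2)
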